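/- arXiv:2411.15617 — 3 statements merged into one kernel-verified Lean document; each statement's English description precedes it below -/
import Mathlib

section
/- Consider two RIS elements (n = 1, 2) whose wave variables satisfy b_n = A_n a_n + B_n a_{n0} and b_{n0} = B_n a_n + D_n a_{n0}, with all quantities complex. Suppose the inner ports are connected through an ideal gyrator, i.e., a_{10} = -b_{20} and a_{20} = b_{10}, and suppose Δ := 1 + D_1 D_2 ≠ 0. Then the outgoing free-space waves satisfy b_1 = (A_1 - B_1² D_2 / Δ) a_1 - (B_1 B_2 / Δ) a_2 and b_2 = (B_1 B_2 / Δ) a_1 + (A_2 - B_2² D_1 / Δ) a_2. -/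
open Matrix

/-- Theorem 2: two RIS elements connected by an ideal gyrator. -/
theorem gyrator_two_element_group
    (A₁ B₁ D₁ A₂ B₂ D₂ a₁ a₂ a₁₀ a₂₀ b₁ b₂ b₁₀ b₂₀ : ℂ)
    (h1 : b₁ = A₁ * a₁ + B₁ * a₁₀) (h1' : b₁₀ = B₁ * a₁ + D₁ * a₁₀)
    (h2 : b₂ = A₂ * a₂ + B₂ * a₂₀) (h2' : b₂₀ = B₂ * a₂ + D₂ * a₂₀)
    (hgy1 : a₁₀ = -b₂₀) (hgy2 : a₂₀ = b₁₀)
    (hΔ : 1 + D₁ * D₂ ≠ 0) :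
    b₁ = (A₁ - B₁ ^ 2 * D₂ / (1 + D₁ * D₂)) * a₁ - (B₁ * B₂ / (1 + D₁ * D₂)) * a₂ ∧
    b₂ = (B₁ * B₂ / (1 + D₁ * D₂)) * a₁ + (A₂ - B₂ ^ 2 * D₁ / (1 + D₁ * D₂)) * a₂ := by
  have e1 : a₁₀ = (-(B₂ * a₂) - D₂ * B₁ * a₁) / (1 + D₁ * D₂) := by
    rw [eq_div_iff hΔ]
    linear_combination hgy1 - h2' - D₂ * hgy2 - D₂ * h1'
  have e2 : a₂₀ = (B₁ * a₁ - D₁ * B₂ * a₂) / (1 + D₁ * D₂) := by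
    rw [eq_div_iff hΔ]
    linear_combination hgy2 + h1' + D₁ * hgy1 - D₁ * h2'
  constructor
  · rw [h1, e1]
    ring
  · rw [h2, e2]
    ring
end

section
/- Consider three RIS elements (n = 1, 2, 3) whose wave variables satisfy b_n = A_n a_n + B_n a_{n0} and b_{n0} = B_n a_n + D_n a_{n0}, with all quantities complex. Suppose the inner ports are connected through an ideal circulator, i.e., a_{10} = b_{30}, a_{20} = b_{10}, a_{30} = b_{20}, and suppose Δ := 1 - D_1 D_2 D_3 ≠ 0. Then (b_1, b_2, b_3) = Φ (a_1, a_2, a_3), where Φ is the 3×3 complex matrix with entries Φ_{11} = A_1 + B_1² D_2 D_3 / Δ, Φ_{12} = B_1 B_2 D_3 / Δ, Φ_{13} = B_1 B_3 / Δ, Φ_{21} = B_1 B_2 / Δ, Φ_{22} = A_2 + B_2² D_1 D_3 / Δ, Φ_{23} = B_2 B_3 D_1 / Δ, Φ_{31} = B_1 B_3 D_2 / Δ, Φ_{32} = B_2 B_3 / Δ, Φ_{33} = A_3 + B_3² D_1 D_2 / Δ. -/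
open Matrix

/-- The wave `x` circulating in a loop of three affine maps with loop gain `D₁ * D₂ * D₃ ≠ 1`. -/
theorem eq_div_of_affine_cycle {K : Type*} [Field K] {D₁ D₂ D₃ c₁ c₂ c₃ x y z : K}
    (hx : x = c₃ + D₃ * z) (hy : y = c₁ + D₁ * x) (hz : z = c₂ + D₂ * y)
    (hΔ : 1 - D₁ * D₂ * D₃ ≠ 0) :
    x = (c₃ + D₃ * c₂ + D₂ * D₃ * c₁) / (1 - D₁ * D₂ * D₃) := by
  rw [eq_div_iff hΔ]
  linear_combination hx + D₃ * hz + D₂ * D₃ * hy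

/-- Theorem 3: three RIS elements connected by an ideal circulator. -/
theorem circulator_three_element_group
    (A₁ B₁ D₁ A₂ B₂ D₂ A₃ B₃ D₃ : ℂ)
    (a₁ a₂ a₃ a₁₀ a₂₀ a₃₀ b₁ b₂ b₃ b₁₀ b₂₀ b₃₀ : ℂ)
    (h1 : b₁ = A₁ * a₁ + B₁ * a₁₀) (h1' : b₁₀ = B₁ * a₁ + D₁ * a₁₀)
    (h2 : b₂ = A₂ * a₂ + B₂ * a₂₀) (h2' : b₂₀ = B₂ * a₂ + D₂ * a₂₀)
    (h3 : b₃ = A₃ * a₃ + B₃ * a₃₀) (h3' : b₃₀ = B₃ * a₃ + D₃ * a₃₀)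
    (hc1 : a₁₀ = b₃₀) (hc2 : a₂₀ = b₁₀) (hc3 : a₃₀ = b₂₀)
    (hΔ : 1 - D₁ * D₂ * D₃ ≠ 0) :
    (!![A₁ + B₁ ^ 2 * D₂ * D₃ / (1 - D₁ * D₂ * D₃), B₁ * B₂ * D₃ / (1 - D₁ * D₂ * D₃),
          B₁ * B₃ / (1 - D₁ * D₂ * D₃);
        B₁ * B₂ / (1 - D₁ * D₂ * D₃), A₂ + B₂ ^ 2 * D₁ * D₃ / (1 - D₁ * D₂ * D₃),
          B₂ * B₃ * D₁ / (1 - D₁ * D₂ * D₃);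
        B₁ * B₃ * D₂ / (1 - D₁ * D₂ * D₃), B₂ * B₃ / (1 - D₁ * D₂ * D₃),
          A₃ + B₃ ^ 2 * D₁ * D₂ / (1 - D₁ * D₂ * D₃)]).mulVec ![a₁, a₂, a₃] =
      ![b₁, b₂, b₃] := by
  subst hc1 hc2 hc3
  have e₁ := eq_div_of_affine_cycle h3' h1' h2' hΔ
  have e₂ := eq_div_of_affine_cycle h1' h2' h3' (by convert hΔ using 2; ring)
  have e₃ := eq_div_of_affine_cycle h2' h3' h1' (by convert hΔ using 2; ring)
  rw [show D₂ * D₃ * D₁ = D₁ * D₂ * D₃ by ring] at e₂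
  rw [show D₃ * D₁ * D₂ = D₁ * D₂ * D₃ by ring] at e₃
  ext i
  fin_cases i <;> simp [Matrix.mulVec, dotProduct, Fin.sum_univ_three]
  · rw [h1, e₁]; ring
  · rw [h2, e₂]; ring
  · rw [h3, e₃]; ring
end

section
/- Consider three RIS elements (n = 1, 2, 3) whose wave variables satisfy b_n = A_n a_n + B_n a_{n0} and b_{n0} = B_n a_n + D_n a_{n0}, connected through an ideal circulator (a_{10} = b_{30}, a_{20} = b_{10}, a_{30} = b_{20}), with Δ := 1 - D_1 D_2 D_3 ≠ 0. If a_2 = 0 and a_3 = 0, then b_{10} = (B_1 / Δ) a_1, a_{10} = (D_2 D_3 B_1 / Δ) a_1, and consequently b_1 = (A_1 + B_1² D_2 D_3 / Δ) a_1. -/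
/-- Intermediate step in the proof of Theorem 3: with excitation only at port 1. -/
theorem circulator_single_excitation
    (A₁ B₁ D₁ A₂ B₂ D₂ A₃ B₃ D₃ : ℂ)
    (a₁ a₂ a₃ a₁₀ a₂₀ a₃₀ b₁ b₂ b₃ b₁₀ b₂₀ b₃₀ : ℂ)
    (h1 : b₁ = A₁ * a₁ + B₁ * a₁₀) (h1' : b₁₀ = B₁ * a₁ + D₁ * a₁₀)
    (h2 : b₂ = A₂ * a₂ + B₂ * a₂₀) (h2' : b₂₀ = B₂ * a₂ + D₂ * a₂₀)
    (h3 : b₃ = A₃ * a₃ + B₃ * a₃₀) (h3' : b₃₀ = B₃ * a₃ + D₃ * a₃₀)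
    (hc1 : a₁₀ = b₃₀) (hc2 : a₂₀ = b₁₀) (hc3 : a₃₀ = b₂₀)
    (hΔ : 1 - D₁ * D₂ * D₃ ≠ 0)
    (ha2 : a₂ = 0) (ha3 : a₃ = 0) :
    b₁₀ = B₁ / (1 - D₁ * D₂ * D₃) * a₁ ∧
    a₁₀ = D₂ * D₃ * B₁ / (1 - D₁ * D₂ * D₃) * a₁ ∧
    b₁ = (A₁ + B₁ ^ 2 * D₂ * D₃ / (1 - D₁ * D₂ * D₃)) * a₁ := by
  have inner_return : a₁₀ = D₂ * D₃ * b₁₀ := by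
    rw [hc1, h3', hc3, h2', hc2, ha2, ha3]
    ring
  have b₁₀_eq : b₁₀ = B₁ / (1 - D₁ * D₂ * D₃) * a₁ := by
    rw [div_mul_eq_mul_div, eq_div_iff hΔ]
    linear_combination h1' + D₁ * inner_return
  have a₁₀_eq : a₁₀ = D₂ * D₃ * B₁ / (1 - D₁ * D₂ * D₃) * a₁ := by
    rw [inner_return, b₁₀_eq]
    ring
  refine ⟨b₁₀_eq, a₁₀_eq, ?_⟩
  rw [h1, a₁₀_eq]
  ring
end
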